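/- arXiv:1709.07310 — 8 statements merged into one kernel-verified Lean document; each statement's English description precedes it below -/
import Mathlib

section
/- Consider the branch shape dynamics on the CB pursuit manifold: θ̇₁ₙ = −(1/ρ₁₂)(sin α₁ + sin θ₂₁) + (1/ρₙ₁)(sin αₙ + sin θ₁ₙ) and ρ̇ₙ₁ = −cos αₙ − cos θ₁ₙ. Suppose the cycle agents are at a circling equilibrium, so θ₂₁ = π − α₁, and suppose sin α₁ ≠ 0. Then for ρ₁₂ > 0 and ρₙ₁ > 0, both right-hand sides vanish (θ̇₁ₙ = 0 and ρ̇ₙ₁ = 0) if and only if θ₁ₙ ≡ π − αₙ (mod 2π) and ρₙ₁ · sin α₁ = ρ₁₂ · sin αₙ; in particular any such equilibrium forces sin αₙ · sin α₁ > 0. -/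
open Real

/-- Branch shape dynamics equilibrium when the cycle is at a circling equilibrium
(θ₂₁ = π - α₁, sin α₁ ≠ 0): both right-hand sides vanish iff θ₁ₙ ≡ π - αₙ (mod 2π)
and ρₙ₁ sin α₁ = ρ₁₂ sin αₙ; in particular any such equilibrium forces
sin αₙ · sin α₁ > 0. -/
theorem branch_circling_equilibrium
    (α₁ αₙ θ₂₁ θ₁ₙ ρ₁₂ ρₙ₁ : ℝ)
    (hρ₁₂ : 0 < ρ₁₂) (hρₙ₁ : 0 < ρₙ₁)
    (hcirc : θ₂₁ = π - α₁) (hs : sin α₁ ≠ 0) :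
    ((-(1 / ρ₁₂) * (sin α₁ + sin θ₂₁) + (1 / ρₙ₁) * (sin αₙ + sin θ₁ₙ) = 0 ∧
        -cos αₙ - cos θ₁ₙ = 0) ↔
      ((∃ k : ℤ, θ₁ₙ = π - αₙ + 2 * π * k) ∧ ρₙ₁ * sin α₁ = ρ₁₂ * sin αₙ)) ∧
    ((-(1 / ρ₁₂) * (sin α₁ + sin θ₂₁) + (1 / ρₙ₁) * (sin αₙ + sin θ₁ₙ) = 0 ∧
        -cos αₙ - cos θ₁ₙ = 0) → sin αₙ * sin α₁ > 0) := by
  subst hcirc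
  have key : (-(1 / ρ₁₂) * (sin α₁ + sin (π - α₁)) + (1 / ρₙ₁) * (sin αₙ + sin θ₁ₙ) = 0) ↔
      ρₙ₁ * (2 * sin α₁) = ρ₁₂ * (sin αₙ + sin θ₁ₙ) := by
    have e : -(1 / ρ₁₂) * (sin α₁ + sin (π - α₁)) + (1 / ρₙ₁) * (sin αₙ + sin θ₁ₙ) =
        (ρ₁₂ * (sin αₙ + sin θ₁ₙ) - ρₙ₁ * (2 * sin α₁)) / (ρ₁₂ * ρₙ₁) := by
      rw [sin_pi_sub]
      field_simp
      ring
    have hne : ρ₁₂ * ρₙ₁ ≠ 0 := by positivity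
    rw [e, div_eq_zero_iff]
    constructor
    · rintro (h | h)
      · linarith
      · exact absurd h hne
    · intro h
      left
      linarith
  rw [key]
  have main : (ρₙ₁ * (2 * sin α₁) = ρ₁₂ * (sin αₙ + sin θ₁ₙ) ∧ -cos αₙ - cos θ₁ₙ = 0) →
      ((∃ k : ℤ, θ₁ₙ = π - αₙ + 2 * π * k) ∧ ρₙ₁ * sin α₁ = ρ₁₂ * sin αₙ) := by
    rintro ⟨h1, h2⟩
    have hc : cos (π - αₙ) = cos θ₁ₙ := by
      rw [cos_pi_sub]
      linarith
    obtain ⟨k, hk | hk⟩ := Real.cos_eq_cos_iff.1 hc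
    · have hk' : θ₁ₙ = π - αₙ + k * (2 * π) := by linarith
      have hsin : sin θ₁ₙ = sin αₙ := by
        rw [hk', sin_add_int_mul_two_pi, sin_pi_sub]
      refine ⟨⟨k, by linarith⟩, ?_⟩
      rw [hsin] at h1
      linarith
    · exfalso
      have hk' : θ₁ₙ = -(π - αₙ) + k * (2 * π) := by linarith
      have hsin : sin θ₁ₙ = -sin αₙ := by
        rw [hk', sin_add_int_mul_two_pi, sin_neg, sin_pi_sub]
      rw [hsin, add_neg_cancel, mul_zero] at h1
      have : ρₙ₁ * (2 * sin α₁) ≠ 0 := by positivity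
      exact this h1
  refine ⟨⟨main, ?_⟩, ?_⟩
  · rintro ⟨⟨k, hk⟩, h⟩
    have hk' : θ₁ₙ = π - αₙ + k * (2 * π) := by linarith
    rw [hk', sin_add_int_mul_two_pi, cos_add_int_mul_two_pi, sin_pi_sub, cos_pi_sub]
    constructor <;> linarith
  · intro h
    have h3 := (main h).2
    have h4 : 0 < ρₙ₁ * (sin α₁ * sin α₁) := mul_pos hρₙ₁ (mul_self_pos.2 hs)
    have h5 : 0 < ρ₁₂ * (sin αₙ * sin α₁) := by
      have : ρ₁₂ * (sin αₙ * sin α₁) = ρₙ₁ * (sin α₁ * sin α₁) := by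
        linear_combination (-sin α₁) * h3
      rw [this]
      exact h4
    exact (mul_pos_iff_of_pos_left hρ₁₂).1 h5
end

section
/- Let α₁, αₙ ∈ ℝ with sin α₁ · sin αₙ > 0, let r₁, rₙ ∈ ℝ² with rₙ ≠ r₁, set ρₙ₁ = ‖rₙ − r₁‖, and let ρ₁₂ > 0 satisfy ρₙ₁/ρ₁₂ = sin αₙ / sin α₁. Define the unit headings x₁ = (1/ρₙ₁)·R(αₙ − π)·(rₙ − r₁) and xₙ = −(1/ρₙ₁)·R(−αₙ)·(rₙ − r₁). Then rₙ + (ρ₁₂/(2 sin α₁))·xₙ^⊥ = r₁ + (ρ₁₂/(2 sin α₁))·x₁^⊥, i.e. the branch agent n orbits on the same circling equilibrium (same circumcenter and radius ρ₁₂/(2 sin α₁)) as agent 1. -/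
open Real

/-- Counterclockwise rotation of the plane ℝ × ℝ by angle β. -/
noncomputable def rot (β : ℝ) (v : ℝ × ℝ) : ℝ × ℝ :=
  (Real.cos β * v.1 - Real.sin β * v.2, Real.sin β * v.1 + Real.cos β * v.2)

/-- Rotation of a planar vector counterclockwise by π/2. -/
def perp (v : ℝ × ℝ) : ℝ × ℝ := (-v.2, v.1)

/-- The branch agent n orbits on the same circling equilibrium (same circumcenter and
radius ρ₁₂/(2 sin α₁)) as agent 1. -/
theorem branch_same_circumcenter
    (α₁ αₙ : ℝ) (hss : sin α₁ * sin αₙ > 0)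
    (r₁ rₙ : ℝ × ℝ) (hne : rₙ ≠ r₁) (ρₙ₁ ρ₁₂ : ℝ)
    (hρₙ₁ : ρₙ₁ = Real.sqrt ((rₙ.1 - r₁.1) ^ 2 + (rₙ.2 - r₁.2) ^ 2))
    (hρ₁₂ : 0 < ρ₁₂) (hratio : ρₙ₁ / ρ₁₂ = sin αₙ / sin α₁)
    (x₁ xₙ : ℝ × ℝ)
    (hx₁ : x₁ = (1 / ρₙ₁) • rot (αₙ - π) (rₙ - r₁))
    (hxₙ : xₙ = -((1 / ρₙ₁) • rot (-αₙ) (rₙ - r₁))) :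
    rₙ + (ρ₁₂ / (2 * sin α₁)) • perp xₙ = r₁ + (ρ₁₂ / (2 * sin α₁)) • perp x₁ := by
  have h1 : sin α₁ ≠ 0 := by rintro h; simp [h] at hss
  have hn : sin αₙ ≠ 0 := by rintro h; simp [h] at hss
  have hρ : ρₙ₁ ≠ 0 := by
    rintro h
    rw [h, zero_div] at hratio
    exact div_ne_zero hn h1 hratio.symm
  have hk : ρ₁₂ / (2 * sin α₁) * (1 / ρₙ₁) * (2 * sin αₙ) = 1 := by
    rw [div_eq_div_iff hρ₁₂.ne' h1] at hratio
    field_simp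
    linarith
  clear hρₙ₁
  subst hx₁ hxₙ
  generalize ρ₁₂ / (2 * sin α₁) = c at *
  generalize 1 / ρₙ₁ = k at *
  ext
  · simp [perp, rot, Real.sin_sub_pi, Real.cos_sub_pi]
    linear_combination (-(rₙ.1 - r₁.1)) * hk
  · simp [perp, rot, Real.sin_sub_pi, Real.cos_sub_pi]
    linear_combination (-(rₙ.2 - r₁.2)) * hk
end

section
/- Let m ≥ 2, let α₁, …, α_m ∈ ℝ, and let ρ₁, …, ρ_m > 0 where ρᵢ denotes the distance ρ_{i,i+1} (indices mod m). Suppose the cycle shape variables take the circling values θ_{i+1,i} = π − αᵢ for all i. Then all the cycle shape dynamics θ̇_{i,i−1} = (1/ρ_{i−1})(sin α_{i−1} + sin θ_{i,i−1}) − (1/ρᵢ)(sin αᵢ + sin θ_{i+1,i}) and ρ̇ᵢ = −cos αᵢ − cos θ_{i+1,i} vanish if and only if ρ_{i+1} · sin αᵢ = ρᵢ · sin α_{i+1} for every i (indices mod m), i.e. the ratios ρᵢ/ρ_{i+1} = sin αᵢ / sin α_{i+1} hold; in particular if some sin αᵢ ≠ 0 then positivity of the ρᵢ forces sin αᵢ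 · sin α_{i+1} > 0 for all i. -/
open Real

/-- In m-agent cyclic CB pursuit with circling shape values θ_{i+1,i} = π - αᵢ,
all the cycle shape dynamics vanish iff ρ_{i+1} sin αᵢ = ρᵢ sin α_{i+1} for all i;
in particular if some sin αᵢ ≠ 0 then positivity of the ρᵢ forces
sin αᵢ · sin α_{i+1} > 0 for all i. Here ρ i stands for ρ_{i,i+1} and
θ i stands for θ_{i+1,i}, with indices in ZMod m. -/
theorem cycle_circling_equilibrium
    (m : ℕ) (hm : 2 ≤ m) (α ρ θ : ZMod m → ℝ)
    (hρ : ∀ i, 0 < ρ i) (hθ : ∀ i, θ i = π - α i) :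
    ((∀ i : ZMod m,
        (1 / ρ (i - 1)) * (sin (α (i - 1)) + sin (θ (i - 1))) -
            (1 / ρ i) * (sin (α i) + sin (θ i)) = 0 ∧
          -cos (α i) - cos (θ i) = 0) ↔
      ∀ i : ZMod m, ρ (i + 1) * sin (α i) = ρ i * sin (α (i + 1))) ∧
    ((∀ i : ZMod m, ρ (i + 1) * sin (α i) = ρ i * sin (α (i + 1))) →
      (∃ i : ZMod m, sin (α i) ≠ 0) →
        ∀ i : ZMod m, sin (α i) * sin (α (i + 1)) > 0) := by
  refine ⟨⟨fun h i => ?_, fun h i => ⟨?_, ?_⟩⟩, ?_⟩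
  · have h1 := (h (i + 1)).1
    have p := hρ i
    have q := hρ (i + 1)
    simp only [hθ, sin_pi_sub, add_sub_cancel_right] at h1
    field_simp at h1
    linarith
  · have h1 := h (i - 1)
    have p := hρ i
    have q := hρ (i - 1)
    simp only [hθ, sin_pi_sub]
    rw [sub_add_cancel] at h1
    field_simp
    linarith
  · rw [hθ, cos_pi_sub]
    ring
  · rintro h ⟨j, hj⟩ i
    have : NeZero m := ⟨by omega⟩
    have step : ∀ n : ℕ, sin (α (j + n)) ≠ 0 := by
      intro n
      induction n with
      | zero => simpa using hj
      | succ n ih =>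
        intro h0
        have h1 := h (j + n)
        rw [add_assoc] at h1
        push_cast at h0
        rw [h0, mul_zero] at h1
        exact ih ((mul_eq_zero.mp h1).resolve_left (hρ _).ne')
    have hi : sin (α i) ≠ 0 := by
      have := step (i - j).val
      rwa [ZMod.natCast_zmod_val, add_sub_cancel] at this
    have p := hρ i
    have q := hρ (i + 1)
    have e : sin (α (i + 1)) = ρ (i + 1) / ρ i * sin (α i) := by
      have := h i
      field_simp
      linarith
    rw [e]
    have : sin (α i) * (ρ (i + 1) / ρ i * sin (α i)) = ρ (i + 1) / ρ i * sin (α i) ^ 2 := by ring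
    rw [this]
    positivity
end

section
/- Let α₁, αₙ, τ ∈ ℝ with sin τ ≠ 0 and sin(α₁ − τ) ≠ 0, and suppose θ₂₁ = π − α₁ + 2τ. Then for θ₁ₙ ∈ ℝ and ρ̃ₙ₁ > 0, the rescaled branch pure-shape dynamics vanish, i.e. (1/ρ̃ₙ₁)(sin αₙ + sin θ₁ₙ) − (sin α₁ + sin θ₂₁) = 0 and ρ̃ₙ₁(cos α₁ + cos θ₂₁) − (cos αₙ + cos θ₁ₙ) = 0, if and only if θ₁ₙ ≡ π − αₙ + 2τ (mod 2π) and ρ̃ₙ₁ = sin(αₙ − τ)/sin(α₁ − τ). In particular such a pure shape equilibrium with ρ̃ₙ₁ > 0 exists if and only if sin(αₙ − τ)·sin(α₁ − τ) > 0. -/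
open Real

lemma aux_sin (a t : ℝ) : sin a + sin (π - a + 2 * t) = 2 * sin (a - t) * cos t := by
  have e1 : sin a = sin ((a - t) + t) := by congr 1; ring
  have e2 : sin (π - a + 2 * t) = sin ((a - t) - t) := by
    rw [← sin_pi_sub]; congr 1; ring
  rw [e1, e2, sin_add, sin_sub (a - t) t]; ring

lemma aux_cos (a t : ℝ) : cos a + cos (π - a + 2 * t) = -(2 * sin (a - t) * sin t) := by
  have e1 : cos a = cos ((a - t) + t) := by congr 1; ring
  have e2 : cos (π - a + 2 * t) = - cos ((a - t) - t) := by
    rw [← cos_pi_sub]; congr 1; ring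
  rw [e1, e2, cos_add, cos_sub (a - t) t]; ring

/-- Pure shape equilibria of the rescaled branch dynamics when the cycle is at a pure
shape equilibrium θ₂₁ = π - α₁ + 2τ with sin τ ≠ 0 and sin(α₁ - τ) ≠ 0: the rescaled
branch dynamics vanish iff θ₁ₙ ≡ π - αₙ + 2τ (mod 2π) and
ρ̃ₙ₁ = sin(αₙ - τ)/sin(α₁ - τ); such an equilibrium with ρ̃ₙ₁ > 0 exists iff
sin(αₙ - τ)·sin(α₁ - τ) > 0. -/
theorem branch_pure_shape_equilibrium
    (α₁ αₙ τ θ₂₁ : ℝ) (hτ : sin τ ≠ 0) (hα : sin (α₁ - τ) ≠ 0)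
    (hθ₂₁ : θ₂₁ = π - α₁ + 2 * τ) :
    (∀ θ₁ₙ ρ : ℝ, 0 < ρ →
      (((1 / ρ) * (sin αₙ + sin θ₁ₙ) - (sin α₁ + sin θ₂₁) = 0 ∧
          ρ * (cos α₁ + cos θ₂₁) - (cos αₙ + cos θ₁ₙ) = 0) ↔
        ((∃ k : ℤ, θ₁ₙ = π - αₙ + 2 * τ + 2 * π * k) ∧
          ρ = sin (αₙ - τ) / sin (α₁ - τ)))) ∧
    ((∃ θ₁ₙ ρ : ℝ, 0 < ρ ∧
        (1 / ρ) * (sin αₙ + sin θ₁ₙ) - (sin α₁ + sin θ₂₁) = 0 ∧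
        ρ * (cos α₁ + cos θ₂₁) - (cos αₙ + cos θ₁ₙ) = 0) ↔
      sin (αₙ - τ) * sin (α₁ - τ) > 0) := by
  subst hθ₂₁
  have main : ∀ θ₁ₙ ρ : ℝ, 0 < ρ →
      (((1 / ρ) * (sin αₙ + sin θ₁ₙ) - (sin α₁ + sin (π - α₁ + 2 * τ)) = 0 ∧
          ρ * (cos α₁ + cos (π - α₁ + 2 * τ)) - (cos αₙ + cos θ₁ₙ) = 0) ↔
        ((∃ k : ℤ, θ₁ₙ = π - αₙ + 2 * τ + 2 * π * k) ∧
          ρ = sin (αₙ - τ) / sin (α₁ - τ))) := by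
    intro θ ρ hρ
    rw [aux_sin, aux_cos]
    have hn1 := aux_sin αₙ τ
    have hn2 := aux_cos αₙ τ
    constructor
    · rintro ⟨h1, h2⟩
      have h1' : sin αₙ + sin θ = ρ * (2 * sin (α₁ - τ) * cos τ) := by
        field_simp at h1
        linarith
      have hr : ρ * sin (α₁ - τ) ≠ 0 := mul_ne_zero hρ.ne' hα
      have key : ρ * sin (α₁ - τ) = sin (αₙ - τ) := by
        apply mul_left_cancel₀ hr
        have a1 : sin θ = 2 * (ρ * sin (α₁ - τ)) * cos τ - sin αₙ := by linarith
        have a2 : cos θ = -(2 * (ρ * sin (α₁ - τ)) * sin τ) - cos αₙ := by linarith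
        have a3 := sin_sq_add_cos_sq θ
        rw [a1, a2] at a3
        rw [sin_sub αₙ τ]
        generalize ρ * sin (α₁ - τ) = r at *
        linear_combination (1/4) * a3 - r ^ 2 * sin_sq_add_cos_sq τ
          - (1/4) * sin_sq_add_cos_sq αₙ
      refine ⟨?_, by rw [eq_div_iff hα, key]⟩
      have b1 : sin θ = sin (π - αₙ + 2 * τ) := by
        linear_combination h1' - hn1 + 2 * cos τ * key
      have b2 : cos θ = cos (π - αₙ + 2 * τ) := by
        linear_combination -h2 - hn2 - 2 * sin τ * key
      have hc : cos (θ - (π - αₙ + 2 * τ)) = 1 := by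
        rw [cos_sub, b1, b2]
        linear_combination sin_sq_add_cos_sq (π - αₙ + 2 * τ)
      obtain ⟨k, hk⟩ := (cos_eq_one_iff _).1 hc
      exact ⟨k, by linarith⟩
    · rintro ⟨⟨k, rfl⟩, hρe⟩
      have key : ρ * sin (α₁ - τ) = sin (αₙ - τ) := by rw [hρe, div_mul_cancel₀ _ hα]
      have c1 : sin (π - αₙ + 2 * τ + 2 * π * k) = sin (π - αₙ + 2 * τ) := by
        rw [mul_comm (2 * π) (k : ℝ)]; exact sin_add_int_mul_two_pi _ k
      have c2 : cos (π - αₙ + 2 * τ + 2 * π * k) = cos (π - αₙ + 2 * τ) := by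
        rw [mul_comm (2 * π) (k : ℝ)]; exact cos_add_int_mul_two_pi _ k
      rw [c1, c2, hn1, hn2, ← key]
      constructor
      · field_simp
        ring
      · ring
  refine ⟨main, ?_, ?_⟩
  · rintro ⟨θ, ρ, hρ, h⟩
    have h3 := ((main θ ρ hρ).1 h).2
    have key : ρ * sin (α₁ - τ) = sin (αₙ - τ) := by rw [h3, div_mul_cancel₀ _ hα]
    rw [← key, mul_assoc]
    exact mul_pos hρ (mul_self_pos.2 hα)
  · intro h
    have hp : 0 < sin (αₙ - τ) / sin (α₁ - τ) := by
      rw [← mul_div_mul_right _ _ hα]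
      exact div_pos h (mul_self_pos.2 hα)
    exact ⟨π - αₙ + 2 * τ, _, hp, (main _ _ hp).2 ⟨⟨0, by simp⟩, rfl⟩⟩
end

section
/- Fix α₁ ∈ ℝ and let θ, ρ : ℝ → ℝ be differentiable functions with ρ(τ) > 0 for all τ, satisfying θ′(τ) = (1 + sin θ(τ))/ρ(τ) − 2 sin α₁ and ρ′(τ) = −cos θ(τ) for all τ. Then the quantity E(θ, ρ) = ρ(1 + sin θ) − ρ² sin α₁ is conserved: the function τ ↦ ρ(τ)(1 + sin θ(τ)) − ρ(τ)² sin α₁ is constant on ℝ. -/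
open Real

/-- Along any solution of θ' = (1 + sin θ)/ρ - 2 sin α₁, ρ' = -cos θ with ρ > 0,
the quantity E(θ, ρ) = ρ(1 + sin θ) - ρ² sin α₁ is conserved. -/
theorem conserved_quantity
    (α₁ : ℝ) (θ ρ : ℝ → ℝ) (hρpos : ∀ τ : ℝ, 0 < ρ τ)
    (hθ : ∀ τ : ℝ, HasDerivAt θ ((1 + sin (θ τ)) / ρ τ - 2 * sin α₁) τ)
    (hρ : ∀ τ : ℝ, HasDerivAt ρ (-cos (θ τ)) τ) :
    ∀ τ₁ τ₂ : ℝ,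
      ρ τ₁ * (1 + sin (θ τ₁)) - (ρ τ₁) ^ 2 * sin α₁ =
        ρ τ₂ * (1 + sin (θ τ₂)) - (ρ τ₂) ^ 2 * sin α₁ := by
  have key : ∀ τ : ℝ, HasDerivAt
      (fun t => ρ t * (1 + sin (θ t)) - (ρ t) ^ 2 * sin α₁) 0 τ := by
    intro τ
    have h1 := ((hρ τ).mul ((hθ τ).sin.const_add 1)).sub
      (((hρ τ).pow 2).mul_const (sin α₁))
    have hne : ρ τ ≠ 0 := (hρpos τ).ne'
    refine HasDerivAt.congr_deriv h1 ?_
    field_simp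
    push_cast
    ring
  intro τ₁ τ₂
  exact is_const_of_deriv_eq_zero (fun τ => (key τ).differentiableAt)
    (fun τ => (key τ).deriv) τ₁ τ₂
end

section
/- Let α₁, α₂, α₃ ∈ ℝ, set β = (α₁ + α₂)/2, and suppose cos(α₃ − β) ≠ 0. Then the 2×2 matrix J with entries J₁₁ = cos(2β − α₃)·cos(α₁ − β)/cos(α₃ − β), J₁₂ = −cos²(α₁ − β)·(sin α₃ + sin(2β − α₃))/cos²(α₃ − β), J₂₁ = sin(2β − α₃), J₂₂ = 2 cos β · cos(α₁ − β), has determinant det J = 2 cos²(α₁ − β). In particular det J > 0 whenever cos(α₁ − β) ≠ 0. -/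
open Real

/-- Determinant of the pure-shape Jacobian of the 3-agent system:
det J = 2 cos²(α₁ - β), where β = (α₁ + α₂)/2; in particular det J > 0 whenever
cos(α₁ - β) ≠ 0. -/
theorem pure_shape_jacobian_det
    (α₁ α₂ α₃ β : ℝ) (hβ : β = (α₁ + α₂) / 2) (h : cos (α₃ - β) ≠ 0) :
    Matrix.det
        !![cos (2 * β - α₃) * cos (α₁ - β) / cos (α₃ - β),
            -(cos (α₁ - β) ^ 2 * (sin α₃ + sin (2 * β - α₃))) / cos (α₃ - β) ^ 2;
          sin (2 * β - α₃), 2 * cos β * cos (α₁ - β)] = 2 * cos (α₁ - β) ^ 2 ∧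
    (cos (α₁ - β) ≠ 0 →
      0 < Matrix.det
        !![cos (2 * β - α₃) * cos (α₁ - β) / cos (α₃ - β),
            -(cos (α₁ - β) ^ 2 * (sin α₃ + sin (2 * β - α₃))) / cos (α₃ - β) ^ 2;
          sin (2 * β - α₃), 2 * cos β * cos (α₁ - β)]) := by
  have key :
    Matrix.det
        !![cos (2 * β - α₃) * cos (α₁ - β) / cos (α₃ - β),
            -(cos (α₁ - β) ^ 2 * (sin α₃ + sin (2 * β - α₃))) / cos (α₃ - β) ^ 2;
          sin (2 * β - α₃), 2 * cos β * cos (α₁ - β)] = 2 * cos (α₁ - β) ^ 2 := by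
    have e1 : sin α₃ + sin (2 * β - α₃) = 2 * sin β * cos (α₃ - β) := by
      have a : α₃ = β + (α₃ - β) := by ring
      have b : 2 * β - α₃ = β - (α₃ - β) := by ring
      have c : sin α₃ = sin (β + (α₃ - β)) := by rw [← a]
      rw [b, c, sin_add β (α₃ - β), sin_sub β (α₃ - β)]; ring
    have e2 : cos β * cos (2 * β - α₃) + sin β * sin (2 * β - α₃) = cos (α₃ - β) := by
      rw [← cos_sub]; congr 1; ring
    rw [Matrix.det_fin_two_of, e1]
    field_simp
    linear_combination (cos (α₁ - β) ^ 2) * e2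
  refine ⟨key, fun h1 => ?_⟩
  rw [key]
  positivity
end

section
/- Let α₁, α₃ ∈ ℝ with sin α₁ · sin α₃ > 0, and consider the 2×2 matrix M = [[−cos α₃ · sin α₁/sin α₃, −2 sin² α₁/sin α₃],[sin α₃, 0]]. Then det M = 2 sin² α₁ > 0 and tr M = −cos α₃ · sin α₁/sin α₃, and consequently: if cos α₃ > 0 then every complex eigenvalue of M has strictly negative real part (the circling equilibrium is linearly stable), while if cos α₃ < 0 then every complex eigenvalue of M has strictly positive real part (the circling equilibrium is unstable). -/
open Real

lemma key_root (t d : ℝ) (ht : t ≠ 0) (hd : 0 < d) (z : ℂ)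
    (hz : z ^ 2 - (t : ℂ) * z + (d : ℂ) = 0) : 0 < t * z.re := by
  have hre := congrArg Complex.re hz
  have him := congrArg Complex.im hz
  simp [pow_two] at hre him
  have h2 : z.im * (2 * z.re - t) = 0 := by linarith
  rcases mul_eq_zero.mp h2 with h0 | h0
  · rw [h0] at hre
    nlinarith [sq_nonneg z.re]
  · have : z.re = t / 2 := by linarith
    rw [this]
    have := sq_pos_of_ne_zero ht
    nlinarith

/-- Stability of the circling equilibrium of the 3-agent system: for the Jacobian
M = [[-cos α₃ sin α₁/sin α₃, -2 sin² α₁/sin α₃],[sin α₃, 0]] with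
sin α₁ · sin α₃ > 0, det M = 2 sin² α₁ > 0 and tr M = -cos α₃ sin α₁/sin α₃, so if
cos α₃ > 0 every complex eigenvalue of M has negative real part (stable), and if
cos α₃ < 0 every complex eigenvalue has positive real part (unstable). -/
theorem circling_stability
    (α₁ α₃ : ℝ) (h : sin α₁ * sin α₃ > 0) :
    (Matrix.det !![-cos α₃ * sin α₁ / sin α₃, -2 * sin α₁ ^ 2 / sin α₃;
        sin α₃, 0] = 2 * sin α₁ ^ 2 ∧
      0 < Matrix.det !![-cos α₃ * sin α₁ / sin α₃, -2 * sin α₁ ^ 2 / sin α₃;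
        sin α₃, 0]) ∧
    Matrix.trace !![-cos α₃ * sin α₁ / sin α₃, -2 * sin α₁ ^ 2 / sin α₃;
        sin α₃, 0] = -cos α₃ * sin α₁ / sin α₃ ∧
    (0 < cos α₃ → ∀ z : ℂ,
      Polynomial.aeval z
          (Matrix.charpoly !![-cos α₃ * sin α₁ / sin α₃, -2 * sin α₁ ^ 2 / sin α₃;
            sin α₃, 0]) = 0 → z.re < 0) ∧
    (cos α₃ < 0 → ∀ z : ℂ,
      Polynomial.aeval z
          (Matrix.charpoly !![-cos α₃ * sin α₁ / sin α₃, -2 * sin α₁ ^ 2 / sin α₃;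
            sin α₃, 0]) = 0 → 0 < z.re) := by
  have h1 : sin α₁ ≠ 0 := left_ne_zero_of_mul h.ne'
  have h3 : sin α₃ ≠ 0 := right_ne_zero_of_mul h.ne'
  have hq : 0 < sin α₁ / sin α₃ := by
    rcases mul_pos_iff.mp h with ⟨a, b⟩ | ⟨a, b⟩
    · exact div_pos a b
    · exact div_pos_of_neg_of_neg a b
  have hdet : Matrix.det !![-cos α₃ * sin α₁ / sin α₃, -2 * sin α₁ ^ 2 / sin α₃;
        sin α₃, 0] = 2 * sin α₁ ^ 2 := by
    rw [Matrix.det_fin_two_of]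
    field_simp
    ring
  have hd : 0 < 2 * sin α₁ ^ 2 := by positivity
  have htr : Matrix.trace !![-cos α₃ * sin α₁ / sin α₃, -2 * sin α₁ ^ 2 / sin α₃;
        sin α₃, 0] = -cos α₃ * sin α₁ / sin α₃ := by
    rw [Matrix.trace_fin_two_of, add_zero]
  have ht : -cos α₃ * sin α₁ / sin α₃ = -cos α₃ * (sin α₁ / sin α₃) := by ring
  have main : cos α₃ ≠ 0 → ∀ z : ℂ,
      Polynomial.aeval z
          (Matrix.charpoly !![-cos α₃ * sin α₁ / sin α₃, -2 * sin α₁ ^ 2 / sin α₃;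
            sin α₃, 0]) = 0 → 0 < (-cos α₃ * (sin α₁ / sin α₃)) * z.re := by
    intro hc z hz
    rw [Matrix.charpoly_fin_two, hdet, htr, ht] at hz
    refine key_root _ _ (mul_ne_zero (neg_ne_zero.mpr hc) hq.ne') hd z ?_
    simpa only [map_add, map_sub, map_mul, map_pow, Polynomial.aeval_X, Polynomial.aeval_C,
      Complex.coe_algebraMap, Complex.ofReal_mul, Complex.ofReal_pow] using hz
  refine ⟨⟨hdet, hdet ▸ hd⟩, htr, fun hc z hz => ?_, fun hc z hz => ?_⟩
  · have := main hc.ne' z hz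
    by_contra hn
    have := mul_nonneg (mul_pos hc hq).le (not_lt.mp hn)
    linarith
  · have := main hc.ne z hz
    exact (mul_pos_iff_of_pos_left (mul_pos (neg_pos.mpr hc) hq)).mp this
end

section
/- Let α₁, α₂, α₃ ∈ ℝ, set β = (α₁ + α₂)/2, and suppose cos(α₁ − β) ≠ 0 and cos(α₁ − β)·cos(α₃ − β) > 0. Consider the 2×2 matrix J with entries J₁₁ = cos(2β − α₃)cos(α₁ − β)/cos(α₃ − β), J₁₂ = −cos²(α₁ − β)(sin α₃ + sin(2β − α₃))/cos²(α₃ − β), J₂₁ = sin(2β − α₃), J₂₂ = 2 cos β cos(α₁ − β). Then: if 2 cos(α₁ + α₂ − α₃) + cos α₃ < 0, every complex eigenvalue of J has strictly negative real part (the pure shape equilibrium is linearly stable); if 2 cos(α₁ + α₂ − α₃) + cos α₃ > 0, every complex eigenvalue of J has strictly positive real part (the pure shape equilibrium is unstable). -/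
open Real

lemma aux_root (a b c d k T D : ℝ) (hT : a + d = k * T) (hk : 0 < k) (hD : a * d - b * c = D)
    (hDp : 0 < D) (z : ℂ)
    (hz : Polynomial.aeval z (Matrix.charpoly !![a, b; c, d]) = 0) :
    (T < 0 → z.re < 0) ∧ (0 < T → 0 < z.re) := by
  rw [Matrix.charpoly_fin_two, Matrix.trace_fin_two_of, Matrix.det_fin_two_of, hT, hD] at hz
  simp only [map_add, map_sub, map_mul, map_pow, Polynomial.aeval_X, Polynomial.aeval_C,
    Complex.coe_algebraMap] at hz
  have hre := congrArg Complex.re hz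
  have him := congrArg Complex.im hz
  simp [pow_two] at hre him
  have h2 : z.im * (2 * z.re - k * T) = 0 := by linarith
  rcases mul_eq_zero.mp h2 with h | h
  · rw [h] at hre
    constructor
    · intro hT
      have := mul_neg_of_pos_of_neg hk hT
      by_contra! hx
      nlinarith
    · intro hT
      have := mul_pos hk hT
      by_contra! hx
      nlinarith
  · constructor
    · intro hT
      have := mul_neg_of_pos_of_neg hk hT
      linarith
    · intro hT
      have := mul_pos hk hT
      linarith

/-- Stability of the pure shape equilibrium of the 3-agent system: with
β = (α₁ + α₂)/2, cos(α₁ - β) ≠ 0 and cos(α₁ - β)·cos(α₃ - β) > 0, every complex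
eigenvalue of the pure-shape Jacobian J has negative real part if
2 cos(α₁ + α₂ - α₃) + cos α₃ < 0 (stable) and positive real part if
2 cos(α₁ + α₂ - α₃) + cos α₃ > 0 (unstable). -/
theorem pure_shape_stability
    (α₁ α₂ α₃ β : ℝ) (hβ : β = (α₁ + α₂) / 2)
    (h₁ : cos (α₁ - β) ≠ 0) (h₂ : 0 < cos (α₁ - β) * cos (α₃ - β)) :
    (2 * cos (α₁ + α₂ - α₃) + cos α₃ < 0 → ∀ z : ℂ,
      Polynomial.aeval z
          (Matrix.charpoly
            !![cos (2 * β - α₃) * cos (α₁ - β) / cos (α₃ - β),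
                -(cos (α₁ - β) ^ 2 * (sin α₃ + sin (2 * β - α₃))) / cos (α₃ - β) ^ 2;
              sin (2 * β - α₃), 2 * cos β * cos (α₁ - β)]) = 0 → z.re < 0) ∧
    (0 < 2 * cos (α₁ + α₂ - α₃) + cos α₃ → ∀ z : ℂ,
      Polynomial.aeval z
          (Matrix.charpoly
            !![cos (2 * β - α₃) * cos (α₁ - β) / cos (α₃ - β),
                -(cos (α₁ - β) ^ 2 * (sin α₃ + sin (2 * β - α₃))) / cos (α₃ - β) ^ 2;
              sin (2 * β - α₃), 2 * cos β * cos (α₁ - β)]) = 0 → 0 < z.re) := by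
  have hd : cos (α₃ - β) ≠ 0 := right_ne_zero_of_mul h₂.ne'
  have hk : 0 < cos (α₁ - β) / cos (α₃ - β) := by
    have : cos (α₁ - β) / cos (α₃ - β) = cos (α₁ - β) * cos (α₃ - β) / cos (α₃ - β) ^ 2 := by
      field_simp
    rw [this]; positivity
  have e1 : α₁ + α₂ - α₃ = 2 * β - α₃ := by rw [hβ]; ring
  rw [e1]
  have hc : cos α₃ + cos (2 * β - α₃) = 2 * cos β * cos (α₃ - β) := by
    rw [cos_add_cos]; congr 3 <;> ring
  have hs : sin α₃ + sin (2 * β - α₃) = 2 * sin β * cos (α₃ - β) := by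
    have p := sin_add β (α₃ - β)
    have q := sin_sub β (α₃ - β)
    rw [show β + (α₃ - β) = α₃ by ring] at p
    rw [show β - (α₃ - β) = 2 * β - α₃ by ring] at q
    linarith
  have hcc : cos β * cos (2 * β - α₃) + sin β * sin (2 * β - α₃) = cos (α₃ - β) := by
    rw [← cos_sub]; congr 1; ring
  have key := aux_root (cos (2 * β - α₃) * cos (α₁ - β) / cos (α₃ - β))
    (-(cos (α₁ - β) ^ 2 * (sin α₃ + sin (2 * β - α₃))) / cos (α₃ - β) ^ 2)
    (sin (2 * β - α₃)) (2 * cos β * cos (α₁ - β)) (cos (α₁ - β) / cos (α₃ - β))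
    (2 * cos (2 * β - α₃) + cos α₃) (2 * cos (α₁ - β) ^ 2)
    (by
      rw [show 2 * cos (2 * β - α₃) + cos α₃
        = cos (2 * β - α₃) + 2 * cos β * cos (α₃ - β) by rw [← hc]; ring]
      field_simp)
    hk
    (by
      rw [hs]
      field_simp
      linear_combination hcc)
    (by positivity)
  exact ⟨fun h z hz => (key z hz).1 h, fun h z hz => (key z hz).2 h⟩
end
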